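/- arXiv:1109.5492 — 3 statements merged into one kernel-verified Lean document; each statement's English description precedes it below -/
import Mathlib

section
/- Fix a real κ > 0 and set Θ(κ) = √(1+κ²) + ln(κ/(1+√(1+κ²))). Then, as the integer n → ∞, one has the asymptotic lim_{n→∞} [π·W_n(nκ)·cosh(2nΘ(κ))] / (n·√(1+κ²)) = 1; that is, W_n(nκ) ∼ (n√(1+κ²)/π)·sech(2nΘ(κ)). -/
open MeasureTheory

noncomputable section

/-- Modified Bessel function of the second kind of integer order `n`, for real argument. -/
def besselK (n : ℕ) (x : ℝ) : ℝ :=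
  ∫ t in Set.Ioi (0:ℝ), Real.exp (-x * Real.cosh t) * Real.cosh (n * t)

/-- Modified Bessel function of the first kind of integer order `n`. -/
def besselI (n : ℕ) (x : ℝ) : ℝ :=
  ∑' k : ℕ, (x/2)^(n+2*k) / (Nat.factorial k * Nat.factorial (n+k))

/-- `M_n = n` for even `n`, `n-1` for odd `n`. -/
def Mn (n : ℕ) : ℕ := if Even n then n else n - 1

/-- The half-integer-order modified Bessel function `K_{n+1/2}` on the slit plane,
using the principal branch of the square root. -/
def Khalf (n : ℕ) (z : ℂ) : ℂ :=
  ((Real.pi : ℂ) / (2*z)) ^ ((1:ℂ)/2) * Complex.exp (-z) *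
    ∑ k ∈ Finset.range (n+1),
      ((n+k).factorial : ℂ) / ((k.factorial : ℂ) * ((n-k).factorial : ℂ) * (2*z)^k)

/-- The polynomial `p_n(z) = Σ_{k=0}^n [(n+k)!/(k!(n-k)!)] (2z)^{n-k}`. -/
def pPoly (n : ℕ) : Polynomial ℂ :=
  ∑ k ∈ Finset.range (n+1),
    Polynomial.C (((n+k).factorial : ℂ) / ((k.factorial : ℂ) * ((n-k).factorial : ℂ)))
      * (2 • Polynomial.X) ^ (n-k)

/-- Modified spherical Bessel function `k_n(z) = √(2/(π z)) K_{n+1/2}(z)`. -/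
def sphk (n : ℕ) (z : ℂ) : ℂ := ((2:ℂ)/((Real.pi : ℂ) * z)) ^ ((1:ℂ)/2) * Khalf n z

/-- Laplace transform. -/
def laplace (f : ℝ → ℂ) (s : ℂ) : ℂ := ∫ t in Set.Ioi (0:ℝ), Complex.exp (-s * t) * f t

/-- Convolution on `[0,∞)`. -/
def conv (f g : ℝ → ℂ) (t : ℝ) : ℂ := ∫ τ in (0:ℝ)..t, f (t - τ) * g τ

/-- The 3-D nonreflecting boundary kernel `σ_{n+1/2}` built from the roots `Z` of `p_n`. -/
def sigma3 {n : ℕ} (b c : ℝ) (Z : Fin n → ℂ) (t : ℝ) : ℂ :=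
  ((c:ℂ)/(b:ℂ)^2) * ∑ j, Z j * Complex.exp ((c:ℂ) * t * Z j / b)

/-- The 3-D nonreflecting boundary kernel `ω_{n+1/2}` built from the roots `Z` of `p_n`. -/
def omega3 {n : ℕ} (b c : ℝ) (Z : Fin n → ℂ) (t : ℝ) : ℂ :=
  -(c:ℂ)/b + ((c:ℂ)/b) * ∑ j, (Complex.exp ((c:ℂ) * t * Z j / b) - 1)

/-- The 2-D nonreflecting boundary kernel `σ_n`, built from the zeros `Z` of (the analytic
continuation of) `K_n`. -/
def sigma2 (n : ℕ) (b c : ℝ) {m : ℕ} (Z : Fin m → ℂ) (t : ℝ) : ℂ :=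
  ((c:ℂ)/(b:ℂ)^2) * (∑ j, Z j * Complex.exp ((c:ℂ) * t * Z j / b)
    + (-1:ℂ)^n * ((∫ r in Set.Ioi (0:ℝ),
        Real.exp (-c*t*r/b) / ((besselK n r)^2 + Real.pi^2 * (besselI n r)^2) : ℝ) : ℂ))

/-- The 2-D nonreflecting boundary kernel `ω_n`. -/
def omega2 (n : ℕ) (b c : ℝ) {m : ℕ} (Z : Fin m → ℂ) (t : ℝ) : ℂ :=
  -(c:ℂ)/(2*b) + ((c:ℂ)/b) * (∑ j, (Complex.exp ((c:ℂ) * t * Z j / b) - 1)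
    + (-1:ℂ)^n * ((∫ r in Set.Ioi (0:ℝ),
        (1 - Real.exp (-c*t*r/b)) / (r * ((besselK n r)^2 + Real.pi^2 * (besselI n r)^2)) : ℝ) : ℂ))

end

section

open Filter Topology Asymptotics

/-- The complex phase `s (cosh w - 1) + sinh w - w`. -/
noncomputable def besselPhase (s : ℝ) (w : ℂ) : ℂ := s * (Complex.cosh w - 1) + Complex.sinh w - w

lemma tendsto_mul_exp_sub_one_sub (z : ℂ) :
    Tendsto (fun n : ℕ => (n : ℂ) * (Complex.exp (z / (√(n : ℝ) : ℝ)) - 1 - z / (√(n : ℝ) : ℝ)))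
      atTop (𝓝 (z ^ 2 / 2)) := by
  have h0 : Tendsto (fun n : ℕ => z / ((√(n : ℝ) : ℝ) : ℂ)) atTop (𝓝 0) := by
    have h1 : Tendsto (fun n : ℕ => ((√(n : ℝ))⁻¹ : ℝ)) atTop (𝓝 0) :=
      tendsto_inv_atTop_zero.comp (Real.tendsto_sqrt_atTop.comp tendsto_natCast_atTop_atTop)
    have h2 := (Complex.continuous_ofReal.tendsto 0).comp h1
    have h3 := h2.const_mul z
    simpa [Function.comp_def, div_eq_mul_inv] using h3
  have h1 := (Complex.exp_sub_sum_range_succ_isLittleO_pow 2).comp_tendsto h0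
  have h2 : (fun n : ℕ => (n : ℂ) * (Complex.exp (z / (√(n : ℝ) : ℝ)) - 1 - z / (√(n : ℝ) : ℝ)
      - (z / (√(n : ℝ) : ℝ)) ^ 2 / 2)) =o[atTop]
      (fun n : ℕ => (n : ℂ) * (z / (√(n : ℝ) : ℝ)) ^ 2) := by
    refine (isBigO_refl _ _).mul_isLittleO (h1.congr_left fun n => ?_)
    simp [Finset.sum_range_succ]
    ring
  have hsq : ∀ᶠ n : ℕ in atTop, (n : ℂ) * (z / (√(n : ℝ) : ℝ)) ^ 2 = z ^ 2 := by
    filter_upwards [eventually_gt_atTop 0] with n hn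
    have h : (((√(n : ℝ) : ℝ) : ℂ)) ^ 2 = n := by
      rw [← Complex.ofReal_pow, Real.sq_sqrt (Nat.cast_nonneg n)]; simp
    have hn' : (n : ℂ) ≠ 0 := by exact_mod_cast hn.ne'
    rw [div_pow, h]; field_simp
  have h3 := (h2.congr' EventuallyEq.rfl hsq).trans_isBigO
    (isBigO_const_const (z ^ 2) (one_ne_zero (α := ℂ)) atTop)
  have h4 := ((isLittleO_one_iff ℂ).1 h3).add_const (z ^ 2 / 2)
  rw [zero_add] at h4
  refine h4.congr' ?_
  filter_upwards [hsq] with n hn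
  linear_combination (-1 / 2 : ℂ) * hn

lemma tendsto_mul_besselPhase (s : ℝ) (z : ℂ) :
    Tendsto (fun n : ℕ => (n : ℂ) * besselPhase s (z / (√(n : ℝ) : ℝ))) atTop
      (𝓝 (s * z ^ 2 / 2)) := by
  have h1 := tendsto_mul_exp_sub_one_sub z
  have h2 := tendsto_mul_exp_sub_one_sub (-z)
  have h3 := (h1.const_mul (((s : ℂ) + 1) / 2)).add (h2.const_mul (((s : ℂ) - 1) / 2))
  convert h3 using 2 with n
  · simp only [besselPhase, Complex.cosh, Complex.sinh, neg_div]
    ring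
  · ring

lemma half_sq_le_cosh_sub_one (u : ℝ) : u ^ 2 / 2 ≤ Real.cosh u - 1 := by
  have h : Real.cosh u - 1 = 2 * Real.sinh (u / 2) ^ 2 := by
    have h1 := Real.cosh_two_mul (u / 2)
    have h2 := Real.cosh_sq (u / 2)
    rw [mul_div_cancel₀ u two_ne_zero] at h1
    linarith
  have h3 : (u / 2) ^ 2 ≤ Real.sinh (u / 2) ^ 2 := by
    rw [sq_le_sq]
    rcases le_total 0 (u / 2) with h0 | h0
    · rw [abs_of_nonneg h0, abs_of_nonneg (Real.sinh_nonneg_iff.2 h0)]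
      exact Real.self_le_sinh_iff.2 h0
    · rw [abs_of_nonpos h0, abs_of_nonpos (Real.sinh_nonpos_iff.2 h0)]
      exact neg_le_neg (Real.sinh_le_self_iff.2 h0)
  rw [h]; linarith

/-- The phase `s (cosh u - 1) + sinh u - u` on the real line. -/
noncomputable def realBesselPhase (s u : ℝ) : ℝ := s * (Real.cosh u - 1) + Real.sinh u - u

lemma le_realBesselPhase {s : ℝ} (hs : 1 ≤ s) (u : ℝ) :
    (s - 1) / 2 * u ^ 2 ≤ realBesselPhase s u := by
  have h1 := half_sq_le_cosh_sub_one u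
  have h2 := Real.add_one_le_exp u
  have h3 := Real.cosh_add_sinh u
  have h4 := mul_le_mul_of_nonneg_left h1 (sub_nonneg.2 hs)
  unfold realBesselPhase
  linarith

lemma ofReal_realBesselPhase (s u : ℝ) : (realBesselPhase s u : ℂ) = besselPhase s u := by
  simp [realBesselPhase, besselPhase]

lemma tendsto_mul_realBesselPhase (s v : ℝ) :
    Tendsto (fun n : ℕ => (n : ℝ) * realBesselPhase s (v / √n)) atTop (𝓝 (s / 2 * v ^ 2)) := by
  have h := (Complex.continuous_re.tendsto _).comp (tendsto_mul_besselPhase s v)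
  have h2 : ((s : ℂ) * (v : ℂ) ^ 2 / 2).re = s / 2 * v ^ 2 := by
    have : ((s : ℂ) * (v : ℂ) ^ 2 / 2) = ((s / 2 * v ^ 2 : ℝ) : ℂ) := by push_cast; ring
    rw [this, Complex.ofReal_re]
  rw [h2] at h
  refine h.congr fun n => ?_
  simp only [Function.comp]
  rw [← Complex.ofReal_div, ← ofReal_realBesselPhase, ← Complex.ofReal_natCast,
    ← Complex.ofReal_mul, Complex.ofReal_re]

lemma continuous_realBesselPhase (s : ℝ) : Continuous (realBesselPhase s) := by
  unfold realBesselPhase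
  fun_prop

lemma integrable_exp_neg_mul_realBesselPhase {s c : ℝ} (hs : 1 < s) (hc : 0 < c) :
    Integrable (fun u => Real.exp (-(c * realBesselPhase s u))) := by
  refine (integrable_exp_neg_mul_sq (b := c * ((s - 1) / 2)) (by nlinarith)).mono'
    (by have := continuous_realBesselPhase s; fun_prop) (ae_of_all _ fun u => ?_)
  rw [Real.norm_of_nonneg (Real.exp_pos _).le, Real.exp_le_exp]
  have := mul_le_mul_of_nonneg_left (le_realBesselPhase hs.le u) hc.le
  linarith

lemma tendsto_sqrt_mul_integral_exp_realBesselPhase {s : ℝ} (hs : 1 < s) :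
    Tendsto (fun n : ℕ => √(n : ℝ) * ∫ u, Real.exp (-(n * realBesselPhase s u))) atTop
      (𝓝 √(2 * Real.pi / s)) := by
  have hg : ∫ v : ℝ, Real.exp (-(s / 2) * v ^ 2) = √(2 * Real.pi / s) := by
    rw [integral_gaussian]; congr 1; field_simp
  rw [← hg]
  have key : Tendsto (fun n : ℕ => ∫ v : ℝ, Real.exp (-(n * realBesselPhase s (v / √n)))) atTop
      (𝓝 (∫ v : ℝ, Real.exp (-(s / 2) * v ^ 2))) := by
    refine tendsto_integral_filter_of_dominated_convergence
      (fun v => Real.exp (-((s - 1) / 2) * v ^ 2)) ?_ ?_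
      (integrable_exp_neg_mul_sq (by linarith)) ?_
    · refine Eventually.of_forall fun n => ?_
      have := continuous_realBesselPhase s
      fun_prop
    · filter_upwards [eventually_gt_atTop 0] with n hn
      refine ae_of_all _ fun v => ?_
      rw [Real.norm_of_nonneg (Real.exp_pos _).le, Real.exp_le_exp]
      have hn' : (0 : ℝ) < n := by exact_mod_cast hn
      have := mul_le_mul_of_nonneg_left (le_realBesselPhase hs.le (v / √n)) hn'.le
      rw [div_pow, Real.sq_sqrt hn'.le] at this
      have h2 : (n : ℝ) * ((s - 1) / 2 * (v ^ 2 / n)) = (s - 1) / 2 * v ^ 2 := by field_simp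
      linarith
    · refine ae_of_all _ fun v => ?_
      refine (Real.continuous_exp.tendsto _).comp ?_
      convert (tendsto_mul_realBesselPhase s v).neg using 2
      ring
  refine key.congr fun n => ?_
  rw [Measure.integral_comp_div (fun u => Real.exp (-(n * realBesselPhase s u))),
    abs_of_nonneg (Real.sqrt_nonneg _), smul_eq_mul]

lemma exists_saddle {κ : ℝ} (hκ : 0 < κ) :
    ∃ t₀ : ℝ, √(1 + κ ^ 2) + Real.log (κ / (1 + √(1 + κ ^ 2))) = √(1 + κ ^ 2) - t₀ ∧
      κ * Real.cosh t₀ = √(1 + κ ^ 2) ∧ κ * Real.sinh t₀ = 1 := by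
  set s := √(1 + κ ^ 2) with hs
  have hs2 : s ^ 2 = 1 + κ ^ 2 := Real.sq_sqrt (by positivity)
  have hs0 : 0 ≤ s := Real.sqrt_nonneg _
  have he : Real.exp (-Real.log (κ / (1 + s))) = (1 + s) / κ := by
    rw [Real.exp_neg, Real.exp_log (by positivity), inv_div]
  refine ⟨-Real.log (κ / (1 + s)), by ring, ?_, ?_⟩
  · rw [Real.cosh_eq, he, neg_neg, Real.exp_log (by positivity)]
    field_simp
    linear_combination -hs2
  · rw [Real.sinh_eq, he, neg_neg, Real.exp_log (by positivity)]
    field_simp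
    linear_combination hs2

lemma one_lt_sqrt_one_add_sq {κ : ℝ} (hκ : 0 < κ) : 1 < √(1 + κ ^ 2) := by
  rw [Real.lt_sqrt zero_le_one]
  nlinarith [sq_pos_of_pos hκ]

lemma besselK_eq_integral {κ : ℝ} (hκ : 0 < κ) {n : ℕ} (hn : 0 < n) :
    besselK n (n * κ) = 1 / 2 * Real.exp (-(n * (√(1 + κ ^ 2) + Real.log (κ / (1 + √(1 + κ ^ 2)))))) *
      ∫ u, Real.exp (-(n * realBesselPhase √(1 + κ ^ 2) u)) := by
  set s := √(1 + κ ^ 2) with hs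
  have hs1 : 1 < s := one_lt_sqrt_one_add_sq hκ
  have hn' : (0 : ℝ) < n := by exact_mod_cast hn
  obtain ⟨t₀, hst, hcosh, hsinh⟩ := exists_saddle hκ
  have hphase (t : ℝ) : Real.exp (-(n * κ) * Real.cosh t + n * t) =
      Real.exp (-(n * (s - t₀))) * Real.exp (-(n * realBesselPhase s (t - t₀))) := by
    rw [← Real.exp_add]
    congr 1
    have h1 : κ * Real.cosh t = s * Real.cosh (t - t₀) + Real.sinh (t - t₀) := by
      conv_lhs => rw [← sub_add_cancel t t₀, Real.cosh_add]
      linear_combination Real.cosh (t - t₀) * hcosh + Real.sinh (t - t₀) * hsinh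
    unfold realBesselPhase
    linear_combination (-n : ℝ) * h1
  have hint : Integrable (fun t : ℝ => Real.exp (-(n * κ) * Real.cosh t + n * t)) := by
    simp_rw [hphase]
    exact ((integrable_exp_neg_mul_realBesselPhase hs1 hn').comp_sub_right t₀).const_mul _
  have hint' : Integrable (fun t : ℝ => Real.exp (-(n * κ) * Real.cosh t - n * t)) := by
    simpa [sub_eq_add_neg] using hint.comp_neg
  have hval : ∫ t : ℝ, Real.exp (-(n * κ) * Real.cosh t + n * t) =
      Real.exp (-(n * (s - t₀))) * ∫ u, Real.exp (-(n * realBesselPhase s u)) := by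
    simp_rw [hphase]
    rw [integral_const_mul,
      integral_sub_right_eq_self (fun u => Real.exp (-(n * realBesselPhase s u))) t₀]
  have hval' : ∫ t : ℝ, Real.exp (-(n * κ) * Real.cosh t - n * t) =
      ∫ t : ℝ, Real.exp (-(n * κ) * Real.cosh t + n * t) := by
    rw [← integral_neg_eq_self]
    simp [sub_eq_add_neg]
  have habs := integral_comp_abs
    (f := fun t : ℝ => Real.exp (-(n * κ) * Real.cosh t) * Real.cosh (n * t))
  have hfull : ∫ t : ℝ, Real.exp (-(n * κ) * Real.cosh |t|) * Real.cosh (n * |t|) =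
      ∫ t : ℝ, Real.exp (-(n * κ) * Real.cosh t + n * t) := by
    have h1 (t : ℝ) : Real.exp (-(n * κ) * Real.cosh |t|) * Real.cosh (n * |t|) =
        1 / 2 * (Real.exp (-(n * κ) * Real.cosh t + n * t)
          + Real.exp (-(n * κ) * Real.cosh t - n * t)) := by
      have h2 : (n : ℝ) * |t| = |n * t| := by rw [abs_mul, abs_of_pos hn']
      rw [h2, Real.cosh_abs, Real.cosh_abs, Real.cosh_eq (n * t), sub_eq_add_neg, Real.exp_add,
        Real.exp_add]
      ring
    simp_rw [h1]
    rw [integral_const_mul, integral_add hint hint', hval']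
    ring
  rw [hfull, hval] at habs
  rw [besselK, hst]
  linarith

lemma integral_exp_int_mul_I (m : ℤ) :
    ∫ θ in (-Real.pi)..Real.pi, Complex.exp (m * Complex.I * θ) = if m = 0 then (2 * Real.pi : ℂ) else 0 := by
  split_ifs with h
  · subst h
    simp
    ring
  · rw [integral_exp_mul_complex (by simp [h]), div_eq_zero_iff, sub_eq_zero]
    left
    rw [Complex.exp_eq_exp_iff_exists_int]
    exact ⟨m, by push_cast; ring⟩

lemma integral_exp_mul_exp_I_mul_exp_neg (A : ℂ) (m : ℕ) :
    ∫ θ in (-Real.pi)..Real.pi, Complex.exp (A * Complex.exp (θ * Complex.I)) *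
      Complex.exp (-(m * (θ * Complex.I))) = 2 * Real.pi * (A ^ m / m.factorial) := by
  have hsum (θ : ℝ) : HasSum (fun j : ℕ => A ^ j / j.factorial *
      Complex.exp (((j - m : ℤ) : ℂ) * Complex.I * θ))
      (Complex.exp (A * Complex.exp (θ * Complex.I)) * Complex.exp (-(m * (θ * Complex.I)))) := by
    have h := (NormedSpace.expSeries_div_hasSum_exp (A * Complex.exp (θ * Complex.I))).mul_right
      (Complex.exp (-(m * (θ * Complex.I))))
    rw [← Complex.exp_eq_exp_ℂ] at h
    refine h.congr_fun fun j => ?_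
    have : Complex.exp (((j - m : ℤ) : ℂ) * Complex.I * θ) =
        Complex.exp (j * (θ * Complex.I)) * Complex.exp (-(m * (θ * Complex.I))) := by
      rw [← Complex.exp_add]; push_cast; ring_nf
    rw [this, mul_pow, ← Complex.exp_nat_mul]
    ring
  have h := intervalIntegral.hasSum_integral_of_dominated_convergence (μ := volume)
    (a := -Real.pi) (b := Real.pi)
    (F := fun (j : ℕ) (θ : ℝ) => A ^ j / j.factorial *
      Complex.exp (((j - m : ℤ) : ℂ) * Complex.I * θ))
    (fun j _ => ‖A‖ ^ j / j.factorial)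
    (fun j => by fun_prop)
    (fun j => ae_of_all _ fun θ _ => by
      have : ((j - m : ℤ) : ℂ) * Complex.I * θ = (((j - m : ℤ) * θ : ℝ) : ℂ) * Complex.I := by
        push_cast; ring
      rw [norm_mul, this, Complex.norm_exp_ofReal_mul_I]
      simp)
    (ae_of_all _ fun θ _ => Real.summable_pow_div_factorial _)
    (by simp)
    (ae_of_all _ fun θ _ => hsum θ)
  refine h.unique ?_
  simp_rw [intervalIntegral.integral_const_mul, integral_exp_int_mul_I]
  refine (hasSum_ite_eq m (2 * (Real.pi : ℂ) * (A ^ m / m.factorial))).congr_fun fun j => ?_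
  by_cases hj : j = m
  · subst hj; simp; ring
  · have : (j : ℤ) - m ≠ 0 := by omega
    simp [hj, this]

lemma integral_exp_cosh_eq_besselI (n : ℕ) (x τ : ℝ) :
    ∫ θ in (-Real.pi)..Real.pi, Complex.exp (x * Complex.cosh (τ + θ * Complex.I)
      - n * (θ * Complex.I)) = ((2 * Real.pi * Real.exp (n * τ) * besselI n x : ℝ) : ℂ) := by
  set A : ℂ := x / 2 * Complex.exp τ with hA
  set B : ℂ := x / 2 * Complex.exp (-τ) with hB
  have hsplit (θ : ℝ) : Complex.exp (x * Complex.cosh (τ + θ * Complex.I) - n * (θ * Complex.I)) =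
      Complex.exp (A * Complex.exp (θ * Complex.I)) * Complex.exp (-(n * (θ * Complex.I))) *
        Complex.exp (B * Complex.exp (-(θ * Complex.I))) := by
    rw [← Complex.exp_add, ← Complex.exp_add, Complex.cosh, neg_add, Complex.exp_add,
      Complex.exp_add, hA, hB]
    ring_nf
  have hsum (θ : ℝ) : HasSum (fun k : ℕ => B ^ k / k.factorial *
      (Complex.exp (A * Complex.exp (θ * Complex.I)) *
        Complex.exp (-((n + k : ℕ) * (θ * Complex.I)))))
      (Complex.exp (x * Complex.cosh (τ + θ * Complex.I) - n * (θ * Complex.I))) := by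
    have h := (NormedSpace.expSeries_div_hasSum_exp (B * Complex.exp (-(θ * Complex.I)))).mul_left
      (Complex.exp (A * Complex.exp (θ * Complex.I)) * Complex.exp (-(n * (θ * Complex.I))))
    rw [← Complex.exp_eq_exp_ℂ, ← hsplit] at h
    refine h.congr_fun fun k => ?_
    have : Complex.exp (-((n + k : ℕ) * (θ * Complex.I))) = Complex.exp (-(n * (θ * Complex.I))) *
        Complex.exp (-(θ * Complex.I)) ^ k := by
      rw [← Complex.exp_nat_mul, ← Complex.exp_add]; push_cast; ring_nf
    rw [this, mul_pow]
    ring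
  have h := intervalIntegral.hasSum_integral_of_dominated_convergence (μ := volume)
    (a := -Real.pi) (b := Real.pi)
    (F := fun (k : ℕ) (θ : ℝ) => B ^ k / k.factorial *
      (Complex.exp (A * Complex.exp (θ * Complex.I)) *
        Complex.exp (-((n + k : ℕ) * (θ * Complex.I)))))
    (fun k _ => ‖B‖ ^ k / k.factorial * Real.exp ‖A‖)
    (fun k => by fun_prop)
    (fun k => ae_of_all _ fun θ _ => by
      have : -((n + k : ℕ) * (θ * Complex.I)) = ((-((n + k : ℕ) * θ) : ℝ) : ℂ) * Complex.I := by
        push_cast; ring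
      rw [norm_mul, norm_mul, this, Complex.norm_exp_ofReal_mul_I, mul_one, norm_div, norm_pow,
        Complex.norm_natCast]
      gcongr
      refine (Complex.norm_exp_le_exp_norm _).trans ?_
      rw [norm_mul, Complex.norm_exp_ofReal_mul_I, mul_one])
    (ae_of_all _ fun θ _ => (Real.summable_pow_div_factorial _).mul_right _)
    (by simp)
    (ae_of_all _ fun θ _ => hsum θ)
  rw [← h.tsum_eq, besselI, ← tsum_mul_left, Complex.ofReal_tsum]
  refine tsum_congr fun k => ?_
  rw [intervalIntegral.integral_const_mul, integral_exp_mul_exp_I_mul_exp_neg, hA, hB]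
  push_cast
  have h1 : Complex.exp (n * τ) * (Complex.exp τ ^ k * Complex.exp (-τ) ^ k)
      = Complex.exp τ ^ (n + k) * Complex.exp (-τ) ^ k := by
    rw [Complex.exp_nat_mul]; ring
  have h2 : Complex.exp τ ^ k * Complex.exp (-τ) ^ k = 1 := by
    rw [← mul_pow, ← Complex.exp_add]; simp
  rw [h2, mul_one] at h1
  rw [h1, mul_pow, mul_pow]
  ring

lemma besselI_eq_integral {κ : ℝ} (hκ : 0 < κ) (n : ℕ) :
    ((2 * Real.pi * Real.exp (-(n * (√(1 + κ ^ 2) + Real.log (κ / (1 + √(1 + κ ^ 2)))))) *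
      besselI n (n * κ) : ℝ) : ℂ) =
      ∫ θ in (-Real.pi)..Real.pi,
        Complex.exp (n * besselPhase √(1 + κ ^ 2) (θ * Complex.I)) := by
  set s := √(1 + κ ^ 2) with hs
  obtain ⟨t₀, hst, hcosh, hsinh⟩ := exists_saddle hκ
  have h := integral_exp_cosh_eq_besselI n (n * κ) t₀
  have hc : (κ : ℂ) * Complex.cosh t₀ = s := by exact_mod_cast congrArg Complex.ofReal hcosh
  have hsi : (κ : ℂ) * Complex.sinh t₀ = 1 := by exact_mod_cast congrArg Complex.ofReal hsinh
  have hphase (θ : ℝ) : Complex.exp (((n * κ : ℝ) : ℂ) * Complex.cosh (t₀ + θ * Complex.I)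
      - n * (θ * Complex.I)) =
      Complex.exp (n * s) * Complex.exp (n * besselPhase s (θ * Complex.I)) := by
    rw [← Complex.exp_add, Complex.cosh_add]
    congr 1
    unfold besselPhase
    push_cast
    linear_combination (n : ℂ) * Complex.cosh (θ * Complex.I) * hc
      + (n : ℂ) * Complex.sinh (θ * Complex.I) * hsi
  simp_rw [hphase] at h
  rw [intervalIntegral.integral_const_mul] at h
  have h3 : Complex.exp (-(n * s)) * Complex.exp (n * s) = 1 := by
    rw [← Complex.exp_add]; simp
  have h5 := congrArg (Complex.exp (-(n * s)) * ·) h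
  simp only [← mul_assoc, h3, one_mul] at h5
  rw [h5, hst]
  have h4 : Real.exp (-(n * (s - t₀))) = Real.exp (-(n * s)) * Real.exp (n * t₀) := by
    rw [← Real.exp_add]; ring_nf
  rw [h4]
  push_cast
  ring

lemma norm_exp_mul_besselPhase_le {s : ℝ} (hs : 0 ≤ s) {c θ : ℝ} (hc : 0 ≤ c) (hθ : |θ| ≤ Real.pi) :
    ‖Complex.exp (c * besselPhase s (θ * Complex.I))‖ ≤
      Real.exp (-(2 * s / Real.pi ^ 2) * (c * θ ^ 2)) := by
  have h : (c * besselPhase s (θ * Complex.I)) =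
      ((c * (s * (Real.cos θ - 1)) : ℝ) : ℂ) + ((c * (Real.sin θ - θ) : ℝ) : ℂ) * Complex.I := by
    unfold besselPhase
    rw [Complex.cosh_mul_I, Complex.sinh_mul_I]
    push_cast
    ring
  rw [h, Complex.norm_exp, Complex.add_re, Complex.re_ofReal_mul, Complex.ofReal_re,
    Complex.I_re, mul_zero, add_zero, Real.exp_le_exp]
  have h1 := mul_le_mul_of_nonneg_left (Real.cos_le_one_sub_mul_cos_sq hθ) (mul_nonneg hc hs)
  have h2 : -(2 * s / Real.pi ^ 2) * (c * θ ^ 2) = c * s * (-(2 / Real.pi ^ 2 * θ ^ 2)) := by ring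
  linarith

lemma tendsto_sqrt_mul_integral_exp_besselPhase {s : ℝ} (hs : 0 < s) :
    Tendsto (fun n : ℕ => ((√(n : ℝ) : ℝ) : ℂ) * ∫ θ in (-Real.pi)..Real.pi,
      Complex.exp (n * besselPhase s (θ * Complex.I))) atTop (𝓝 (√(2 * Real.pi / s) : ℝ)) := by
  have hg : ∫ v : ℝ, Complex.exp (s * (v * Complex.I) ^ 2 / 2) = (√(2 * Real.pi / s) : ℝ) := by
    have h1 : √(2 * Real.pi / s) = ∫ v : ℝ, Real.exp (-(s / 2) * v ^ 2) := by
      rw [integral_gaussian]; congr 1; field_simp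
    rw [h1, ← integral_complex_ofReal]
    refine integral_congr_ae (ae_of_all _ fun v => ?_)
    push_cast
    rw [mul_pow, Complex.I_sq]
    ring_nf
  rw [← hg]
  set G : ℕ → ℝ → ℂ := fun n => (Set.Ioc (-Real.pi) Real.pi).indicator
    (fun θ => Complex.exp (n * besselPhase s (θ * Complex.I))) with hG
  have hGint (n : ℕ) : ∫ θ in (-Real.pi)..Real.pi,
      Complex.exp (n * besselPhase s (θ * Complex.I)) = ∫ θ, G n θ := by
    rw [hG, integral_indicator measurableSet_Ioc,
      intervalIntegral.integral_of_le (by linarith [Real.pi_pos])]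
  have hcont (n : ℕ) : Continuous
      (fun θ : ℝ => Complex.exp (n * besselPhase s (θ * Complex.I))) := by
    unfold besselPhase
    fun_prop
  have key : Tendsto (fun n : ℕ => ∫ v : ℝ, G n (v / √n)) atTop
      (𝓝 (∫ v : ℝ, Complex.exp (s * (v * Complex.I) ^ 2 / 2))) := by
    refine tendsto_integral_filter_of_dominated_convergence
      (fun v => Real.exp (-(2 * s / Real.pi ^ 2) * v ^ 2)) ?_ ?_
      (integrable_exp_neg_mul_sq (by positivity)) ?_
    · refine Eventually.of_forall fun n => ?_
      exact (((hcont n).measurable.indicator measurableSet_Ioc).comp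
        (measurable_id.div_const _)).aestronglyMeasurable
    · filter_upwards [eventually_gt_atTop 0] with n hn
      refine ae_of_all _ fun v => ?_
      have hn' : (0 : ℝ) < n := by exact_mod_cast hn
      by_cases hv : v / √n ∈ Set.Ioc (-Real.pi) Real.pi
      · simp only [hG, Set.indicator_of_mem hv]
        have h := norm_exp_mul_besselPhase_le hs.le hn'.le (abs_le.2 ⟨hv.1.le, hv.2⟩)
        rw [div_pow, Real.sq_sqrt hn'.le, mul_div_cancel₀ _ hn'.ne'] at h
        exact_mod_cast h
      · simp only [hG, Set.indicator_of_notMem hv, norm_zero]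
        positivity
    · refine ae_of_all _ fun v => ?_
      have h0 : Tendsto (fun n : ℕ => v / √n) atTop (𝓝 0) :=
        (Real.tendsto_sqrt_atTop.comp tendsto_natCast_atTop_atTop).const_div_atTop v
      have h1 : Tendsto (fun n : ℕ => Complex.exp (n * besselPhase s ((v / √n : ℝ) * Complex.I)))
          atTop (𝓝 (Complex.exp (s * (v * Complex.I) ^ 2 / 2))) := by
        refine (Complex.continuous_exp.tendsto _).comp ?_
        refine (tendsto_mul_besselPhase s (v * Complex.I)).congr fun n => ?_
        push_cast
        ring_nf
      refine h1.congr' ?_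
      filter_upwards [h0.eventually (Ioc_mem_nhds (neg_neg_of_pos Real.pi_pos) Real.pi_pos)] with n hn
      exact (Set.indicator_of_mem (s := Set.Ioc (-Real.pi) Real.pi) hn
        (fun θ : ℝ => Complex.exp (n * besselPhase s (θ * Complex.I)))).symm
  refine key.congr fun n => ?_
  rw [hGint, Measure.integral_comp_div (G n), abs_of_nonneg (Real.sqrt_nonneg _),
    Complex.real_smul]

lemma tendsto_sqrt_mul_exp_mul_besselK {κ : ℝ} (hκ : 0 < κ) :
    Tendsto (fun n : ℕ => √(n : ℝ) *
      (Real.exp (n * (√(1 + κ ^ 2) + Real.log (κ / (1 + √(1 + κ ^ 2))))) * besselK n (n * κ)))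
      atTop (𝓝 (1 / 2 * √(2 * Real.pi / √(1 + κ ^ 2)))) := by
  refine ((tendsto_sqrt_mul_integral_exp_realBesselPhase
    (one_lt_sqrt_one_add_sq hκ)).const_mul (1 / 2)).congr' ?_
  filter_upwards [eventually_gt_atTop 0] with n hn
  rw [besselK_eq_integral hκ hn, Real.exp_neg]
  field_simp

lemma tendsto_sqrt_mul_exp_neg_mul_besselI {κ : ℝ} (hκ : 0 < κ) :
    Tendsto (fun n : ℕ => √(n : ℝ) *
      (Real.exp (-(n * (√(1 + κ ^ 2) + Real.log (κ / (1 + √(1 + κ ^ 2)))))) * besselI n (n * κ)))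
      atTop (𝓝 (1 / (2 * Real.pi) * √(2 * Real.pi / √(1 + κ ^ 2)))) := by
  have h := (Complex.continuous_re.tendsto _).comp (tendsto_sqrt_mul_integral_exp_besselPhase
    (zero_lt_one.trans (one_lt_sqrt_one_add_sq hκ)))
  rw [Complex.ofReal_re] at h
  refine (h.const_mul (1 / (2 * Real.pi))).congr fun n => ?_
  simp only [Function.comp]
  rw [← besselI_eq_integral hκ, ← Complex.ofReal_mul, Complex.ofReal_re]
  have := Real.pi_pos
  field_simp

lemma tendsto_weighted_average {a b : ℕ → ℝ} (ha : Tendsto a atTop (𝓝 1))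
    (hb : Tendsto b atTop (𝓝 1)) (x : ℕ → ℝ) :
    Tendsto (fun n => (a n * Real.exp (-x n) + b n * Real.exp (x n)) / (2 * Real.cosh (x n)))
      atTop (𝓝 1) := by
  have h0 : Tendsto (fun n => |a n - 1| + |b n - 1|) atTop (𝓝 0) := by
    have h1 := (ha.sub_const 1).abs.add (hb.sub_const 1).abs
    simpa using h1
  rw [tendsto_iff_norm_sub_tendsto_zero]
  refine squeeze_zero (fun n => norm_nonneg _) (fun n => ?_) h0
  have hc := Real.cosh_pos (x n)
  have he : 2 * Real.cosh (x n) = Real.exp (x n) + Real.exp (-x n) := by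
    rw [Real.cosh_eq]; ring
  have h1 := Real.exp_pos (x n)
  have h2 := Real.exp_pos (-x n)
  have h3 : (a n * Real.exp (-x n) + b n * Real.exp (x n)) / (2 * Real.cosh (x n)) - 1 =
      ((a n - 1) * Real.exp (-x n) + (b n - 1) * Real.exp (x n)) / (2 * Real.cosh (x n)) := by
    rw [he]; field_simp; ring
  rw [h3, Real.norm_eq_abs, abs_div, abs_of_pos (by positivity : 0 < 2 * Real.cosh (x n)),
    div_le_iff₀ (by positivity)]
  refine (abs_add_le _ _).trans ?_
  rw [abs_mul, abs_mul, abs_of_pos h1, abs_of_pos h2, he]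
  nlinarith [mul_nonneg (abs_nonneg (a n - 1)) h1.le, mul_nonneg (abs_nonneg (b n - 1)) h2.le]

end

/-- uniform asymptotics `W_n(nκ) ∼ (n√(1+κ²)/π) sech(2nΘ(κ))` as `n → ∞`. -/
theorem stmt_6 (κ : ℝ) (hκ : 0 < κ) :
    Filter.Tendsto
      (fun n : ℕ =>
        Real.pi * (1 / ((besselK n (n*κ))^2 + Real.pi^2 * (besselI n (n*κ))^2))
          * Real.cosh (2*n*(Real.sqrt (1+κ^2) + Real.log (κ / (1 + Real.sqrt (1+κ^2)))))
          / (n * Real.sqrt (1+κ^2)))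
      Filter.atTop (nhds 1) := by
  set s := √(1 + κ ^ 2) with hs
  set Θ := s + Real.log (κ / (1 + s)) with hΘ
  have hs1 : 1 < s := one_lt_sqrt_one_add_sq hκ
  have hs0 : 0 < s := zero_lt_one.trans hs1
  have hπ := Real.pi_pos
  have hsq : √(2 * Real.pi / s) ^ 2 = 2 * Real.pi / s := Real.sq_sqrt (by positivity)
  have hK := ((tendsto_sqrt_mul_exp_mul_besselK hκ).pow 2).const_mul (2 * s / Real.pi)
  have hI := ((tendsto_sqrt_mul_exp_neg_mul_besselI hκ).pow 2).const_mul (2 * s * Real.pi)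
  rw [← hs, ← hΘ, mul_pow, hsq] at hK hI
  have hK1 : 2 * s / Real.pi * ((1 / 2) ^ 2 * (2 * Real.pi / s)) = 1 := by field_simp
  have hI1 : 2 * s * Real.pi * ((1 / (2 * Real.pi)) ^ 2 * (2 * Real.pi / s)) = 1 := by
    field_simp
  rw [hK1] at hK
  rw [hI1] at hI
  have h := (tendsto_weighted_average hK hI fun n => 2 * n * Θ).inv₀ one_ne_zero
  rw [inv_one] at h
  refine h.congr fun n => ?_
  have hnn : √(n : ℝ) ^ 2 = n := Real.sq_sqrt (Nat.cast_nonneg n)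
  have he1 : Real.exp (n * Θ) ^ 2 * Real.exp (-(2 * n * Θ)) = 1 := by
    rw [← Real.exp_nat_mul, ← Real.exp_add, Real.exp_eq_one_iff]; push_cast; ring
  have he2 : Real.exp (-(n * Θ)) ^ 2 * Real.exp (2 * n * Θ) = 1 := by
    rw [← Real.exp_nat_mul, ← Real.exp_add, Real.exp_eq_one_iff]; push_cast; ring
  have hnum : 2 * s / Real.pi * (√(n : ℝ) * (Real.exp (n * Θ) * besselK n (n * κ))) ^ 2 *
        Real.exp (-(2 * n * Θ)) +
      2 * s * Real.pi * (√(n : ℝ) * (Real.exp (-(n * Θ)) * besselI n (n * κ))) ^ 2 *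
        Real.exp (2 * n * Θ) =
      2 * n * s / Real.pi * (besselK n (n * κ) ^ 2 + Real.pi ^ 2 * besselI n (n * κ) ^ 2) := by
    have h1 : 2 * s / Real.pi * (√(n : ℝ) * (Real.exp (n * Θ) * besselK n (n * κ))) ^ 2 *
        Real.exp (-(2 * n * Θ)) = 2 * n * s / Real.pi * besselK n (n * κ) ^ 2 := by
      linear_combination 2 * s / Real.pi * besselK n (n * κ) ^ 2 * (hnn + √(n : ℝ) ^ 2 * he1)
    have h2 : 2 * s * Real.pi * (√(n : ℝ) * (Real.exp (-(n * Θ)) * besselI n (n * κ))) ^ 2 *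
        Real.exp (2 * n * Θ) = 2 * n * s * Real.pi * besselI n (n * κ) ^ 2 := by
      linear_combination 2 * s * Real.pi * besselI n (n * κ) ^ 2 * (hnn + √(n : ℝ) ^ 2 * he2)
    rw [h1, h2]
    field_simp
  rw [hnum, inv_div]
  generalize besselK n (n * κ) ^ 2 + Real.pi ^ 2 * besselI n (n * κ) ^ 2 = X
  simp only [div_eq_mul_inv, mul_inv, inv_inv]
  ring
end

section
/- Let n ≥ 0 be an integer and write z = z_1 + i z_2 with real z_1, z_2. Then for every z with z_1 > 0 (where k_n(z) ≠ 0), one has z_2 · Im( z · k_n'(z)/k_n(z) ) ≤ 0. In particular, Im( z · k_n'(z)/k_n(z) ) ≤ 0 whenever z_1 > 0 and z_2 ≥ 0. -/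
open MeasureTheory

open scoped ComplexConjugate

/-- Coefficient of `(2z)^{-k}` in `z e^z k_n(z)`, extended by zero to `k > n`. -/
noncomputable def sphkCoeff (n k : ℕ) : ℂ :=
  if k ≤ n then ((n + k).factorial : ℂ) / ((k.factorial : ℂ) * ((n - k).factorial : ℂ)) else 0

lemma sphkCoeff_of_lt {n k : ℕ} (h : n < k) : sphkCoeff n k = 0 :=
  if_neg (not_le.mpr h)

lemma sphkCoeff_add_left (m k : ℕ) :
    sphkCoeff (k + m) k
      = ((k + m + k).factorial : ℂ) / ((k.factorial : ℂ) * (m.factorial : ℂ)) := by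
  simp [sphkCoeff]

lemma sphkCoeff_zero (n : ℕ) : sphkCoeff n 0 = 1 := by
  simp [sphkCoeff, Nat.factorial_ne_zero]

lemma sphkCoeff_succ_succ (n k : ℕ) :
    sphkCoeff (n + 1) (k + 1)
      = sphkCoeff n (k + 1) + 2 * (n + 1 + k) * sphkCoeff n k := by
  rcases lt_trichotomy n k with h | rfl | h
  · rw [sphkCoeff_of_lt (by lia), sphkCoeff_of_lt (by lia), sphkCoeff_of_lt h]
    ring
  · rw [sphkCoeff_of_lt (Nat.lt_succ_self n)]
    have h1 := sphkCoeff_add_left 0 (n + 1)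
    have h2 := sphkCoeff_add_left 0 n
    rw [add_zero] at h1 h2
    rw [h1, h2, show n + 1 + (n + 1) = n + n + 1 + 1 by ring]
    have := Nat.factorial_ne_zero n
    simp only [Nat.factorial_succ, Nat.factorial_zero]
    push_cast
    have : (n : ℂ) + 1 ≠ 0 := by exact_mod_cast n.succ_ne_zero
    field_simp
    ring
  · obtain ⟨m, rfl⟩ := Nat.exists_eq_add_of_lt h
    have h1 := sphkCoeff_add_left (m + 1) (k + 1)
    have h2 := sphkCoeff_add_left m (k + 1)
    have h3 := sphkCoeff_add_left (m + 1) k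
    rw [show k + 1 + (m + 1) = k + m + 1 + 1 by ring,
      show k + m + 1 + 1 + (k + 1) = k + m + 1 + k + 1 + 1 by ring] at h1
    rw [show k + 1 + m = k + m + 1 by ring,
      show k + m + 1 + (k + 1) = k + m + 1 + k + 1 by ring] at h2
    rw [← add_assoc] at h3
    rw [h1, h2, h3, Nat.factorial_succ (k + m + 1 + k + 1), Nat.factorial_succ (k + m + 1 + k),
      Nat.factorial_succ k, Nat.factorial_succ m]
    have hk : (k : ℂ) + 1 ≠ 0 := by exact_mod_cast k.succ_ne_zero
    have hm : (m : ℂ) + 1 ≠ 0 := by exact_mod_cast m.succ_ne_zero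
    have := Nat.factorial_ne_zero k
    have := Nat.factorial_ne_zero m
    push_cast
    field_simp
    ring

lemma sphkCoeff_mul_sub (n k : ℕ) :
    sphkCoeff n (k + 1) * (k + 1) = (n + k + 1) * (n - k) * sphkCoeff n k := by
  rcases lt_trichotomy n k with h | rfl | h
  · rw [sphkCoeff_of_lt (by lia), sphkCoeff_of_lt h]
    ring
  · rw [sphkCoeff_of_lt (Nat.lt_succ_self n)]
    ring
  · obtain ⟨m, rfl⟩ := Nat.exists_eq_add_of_lt h
    have h2 := sphkCoeff_add_left m (k + 1)
    have h3 := sphkCoeff_add_left (m + 1) k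
    rw [show k + 1 + m = k + m + 1 by ring,
      show k + m + 1 + (k + 1) = k + m + 1 + k + 1 by ring] at h2
    rw [← add_assoc] at h3
    rw [h2, h3, Nat.factorial_succ (k + m + 1 + k), Nat.factorial_succ k, Nat.factorial_succ m]
    have hk : (k : ℂ) + 1 ≠ 0 := by exact_mod_cast k.succ_ne_zero
    have hm : (m : ℂ) + 1 ≠ 0 := by exact_mod_cast m.succ_ne_zero
    have := Nat.factorial_ne_zero k
    have := Nat.factorial_ne_zero m
    push_cast
    field_simp
    ring

lemma sphkCoeff_add_two (n k : ℕ) :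
    sphkCoeff (n + 2) (k + 1)
      = 2 * (2 * n + 3) * sphkCoeff (n + 1) k + sphkCoeff n (k + 1) := by
  have h1 := sphkCoeff_succ_succ (n + 1) k
  have h2 := sphkCoeff_succ_succ n k
  have h3 : ((n : ℂ) + 1 - k) * sphkCoeff (n + 1) k = (n + 1 + k) * sphkCoeff n k := by
    rcases k with _ | k
    · simp [sphkCoeff_zero]
    · have h4 := sphkCoeff_mul_sub n k
      have h5 := sphkCoeff_succ_succ n k
      rw [h5]
      push_cast
      linear_combination -2 * h4
  push_cast at h1 h2
  linear_combination h1 + h2 - 2 * h3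

/-- `z e^z k_n(z)` as a polynomial in `v = 1 / (2z)`. -/
noncomputable def sphkSum (n : ℕ) (v : ℂ) : ℂ := ∑ k ∈ Finset.range (n + 1), sphkCoeff n k * v ^ k

lemma sum_range_sphkCoeff {n N : ℕ} (h : n + 1 ≤ N) (v : ℂ) :
    ∑ k ∈ Finset.range N, sphkCoeff n k * v ^ k = sphkSum n v := by
  refine (Finset.sum_subset (Finset.range_mono h) fun k _ hk => ?_).symm
  rw [sphkCoeff_of_lt (by simpa using hk), zero_mul]

lemma sphkSum_eq_sum_succ_add_one {n N : ℕ} (h : n ≤ N) (v : ℂ) :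
    sphkSum n v = (∑ k ∈ Finset.range N, sphkCoeff n (k + 1) * v ^ (k + 1)) + 1 := by
  rw [← sum_range_sphkCoeff (Nat.succ_le_succ h), Finset.sum_range_succ', sphkCoeff_zero]
  simp

lemma sphkSum_add_two (n : ℕ) (v : ℂ) :
    sphkSum (n + 2) v = 2 * (2 * n + 3) * v * sphkSum (n + 1) v + sphkSum n v := by
  rw [sphkSum_eq_sum_succ_add_one le_rfl,
    sphkSum_eq_sum_succ_add_one (n := n) (N := n + 2) (by lia),
    ← sum_range_sphkCoeff (n := n + 1) le_rfl, ← add_assoc, Finset.mul_sum,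
    ← Finset.sum_add_distrib]
  congr 1
  refine Finset.sum_congr rfl fun k _ => ?_
  rw [sphkCoeff_add_two]
  ring

lemma hasDerivAt_sphkSum_inv (n : ℕ) {z : ℂ} (hz : z ≠ 0) :
    HasDerivAt (fun w : ℂ => sphkSum n (2 * w)⁻¹)
      (sphkSum n (2 * z)⁻¹ * (1 + (n + 1) / z) - sphkSum (n + 1) (2 * z)⁻¹) z := by
  have hv : HasDerivAt (fun w : ℂ => (2 * w)⁻¹) (-2 * (2 * z)⁻¹ ^ 2) z := by
    refine (((hasDerivAt_id' z).const_mul (2 : ℂ)).fun_inv (by simpa using hz)).congr_deriv ?_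
    field_simp
  have h : HasDerivAt (fun w : ℂ => sphkSum n (2 * w)⁻¹)
      (∑ k ∈ Finset.range (n + 1),
        sphkCoeff n k * (k * (2 * z)⁻¹ ^ (k - 1) * (-2 * (2 * z)⁻¹ ^ 2))) z :=
    HasDerivAt.fun_sum fun k _ => (hv.fun_pow k).const_mul _
  convert h using 1
  have hdiv : ((n : ℂ) + 1) / z = 2 * (n + 1) * (2 * z)⁻¹ := by field_simp
  rw [hdiv]
  generalize (2 * z)⁻¹ = v
  rw [mul_add, mul_one, sphkSum_eq_sum_succ_add_one (n := n + 1) le_rfl]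
  nth_rewrite 1 [sphkSum_eq_sum_succ_add_one (n := n) (N := n + 1) (by lia)]
  rw [sphkSum, Finset.sum_mul, add_right_comm, add_sub_add_right_eq_sub,
    ← Finset.sum_add_distrib, ← Finset.sum_sub_distrib]
  refine Finset.sum_congr rfl fun k _ => ?_
  rw [sphkCoeff_succ_succ]
  rcases k with _ | k
  · push_cast
    ring
  · rw [Nat.add_sub_cancel]
    push_cast
    ring

lemma ofReal_mul_cpow {r : ℝ} (hr : 0 < r) {z : ℂ} (hz : z ≠ 0) (w : ℂ) :
    ((r : ℂ) * z) ^ w = (r : ℂ) ^ w * z ^ w := by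
  have hr0 : (r : ℂ) ≠ 0 := by exact_mod_cast hr.ne'
  rw [Complex.cpow_def_of_ne_zero (mul_ne_zero hr0 hz), Complex.cpow_def_of_ne_zero hr0,
    Complex.cpow_def_of_ne_zero hz, Complex.log_ofReal_mul hr hz, Complex.ofReal_log hr.le,
    add_mul, Complex.exp_add]

lemma sphk_eq {z : ℂ} (hz : z ≠ 0) (n : ℕ) :
    sphk n z = z⁻¹ * Complex.exp (-z) * sphkSum n (2 * z)⁻¹ := by
  have hsum : ∑ k ∈ Finset.range (n + 1),
      ((n + k).factorial : ℂ) / ((k.factorial : ℂ) * ((n - k).factorial : ℂ) * (2 * z) ^ k)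
        = sphkSum n (2 * z)⁻¹ := by
    refine Finset.sum_congr rfl fun k hk => ?_
    rw [sphkCoeff, if_pos (Nat.lt_succ_iff.mp (Finset.mem_range.mp hk)), inv_pow,
      ← div_eq_mul_inv, div_div]
  have h1 : (2 : ℂ) / (Real.pi * z) = ((2 / Real.pi : ℝ) : ℂ) * z⁻¹ := by
    push_cast
    field_simp
  have h2 : (Real.pi : ℂ) / (2 * z) = ((Real.pi / 2 : ℝ) : ℂ) * z⁻¹ := by
    push_cast
    field_simp
  have hr1 : (0 : ℝ) < 2 / Real.pi := by positivity
  have hr2 : (0 : ℝ) < Real.pi / 2 := by positivity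
  have hone : ((2 / Real.pi : ℝ) : ℂ) ^ ((1 : ℂ) / 2) * ((Real.pi / 2 : ℝ) : ℂ) ^ ((1 : ℂ) / 2)
      = 1 := by
    rw [← Complex.mul_cpow_ofReal_nonneg hr1.le hr2.le, ← Complex.ofReal_mul,
      div_mul_div_cancel₀ Real.pi_ne_zero, div_self two_ne_zero, Complex.ofReal_one,
      Complex.one_cpow]
  have hinv : z⁻¹ ^ ((1 : ℂ) / 2) * z⁻¹ ^ ((1 : ℂ) / 2) = z⁻¹ := by
    rw [← Complex.cpow_add _ _ (inv_ne_zero hz), add_halves, Complex.cpow_one]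
  rw [sphk, Khalf, hsum, h1, h2, ofReal_mul_cpow hr1 (inv_ne_zero hz),
    ofReal_mul_cpow hr2 (inv_ne_zero hz)]
  linear_combination
    (Complex.exp (-z) * sphkSum n (2 * z)⁻¹) *
      (z⁻¹ ^ ((1 : ℂ) / 2) * z⁻¹ ^ ((1 : ℂ) / 2) * hone + hinv)

lemma mul_sphk_one {z : ℂ} (hz : z ≠ 0) : z * sphk 1 z = (1 + z) * sphk 0 z := by
  have h0 : sphkSum 0 (2 * z)⁻¹ = 1 := by simp [sphkSum, sphkCoeff_zero]
  have h1 : sphkSum 1 (2 * z)⁻¹ = 1 + 1 / z := by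
    rw [sphkSum, Finset.sum_range_succ, Finset.sum_range_one, sphkCoeff_zero]
    norm_num [sphkCoeff, Nat.factorial]
    ring
  rw [sphk_eq hz, sphk_eq hz, h0, h1]
  field_simp
  ring

lemma mul_sphk_add_two {z : ℂ} (hz : z ≠ 0) (n : ℕ) :
    z * sphk (n + 2) z = (2 * n + 3) * sphk (n + 1) z + z * sphk n z := by
  rw [sphk_eq hz, sphk_eq hz, sphk_eq hz, sphkSum_add_two]
  field_simp

lemma deriv_sphk {z : ℂ} (hz : z ≠ 0) (n : ℕ) :
    deriv (sphk n) z = n / z * sphk n z - sphk (n + 1) z := by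
  have h := ((hasDerivAt_inv hz).fun_mul (hasDerivAt_neg z).cexp).fun_mul
    (hasDerivAt_sphkSum_inv n hz)
  have heq : sphk n =ᶠ[nhds z] fun w => w⁻¹ * Complex.exp (-w) * sphkSum n (2 * w)⁻¹ :=
    (eventually_ne_nhds hz).mono fun w hw => sphk_eq hw n
  rw [(h.congr_of_eventuallyEq heq).deriv, sphk_eq hz, sphk_eq hz]
  field_simp
  ring

/-- The ratios `z k_{n+1}(z) / k_n(z)` stay in the convex cone spanned by `1` and `z²`. -/
lemma sphk_ratio_mem_cone {z : ℂ} (hz : 0 < z.re) {s : ℝ} (hs : 0 ≤ s * z.im) (n : ℕ) :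
    0 ≤ s * (z * sphk (n + 1) z * conj (sphk n z)).im ∧
      0 ≤ s * (z ^ 2 * conj (z * sphk (n + 1) z * conj (sphk n z))).im := by
  have hz0 : z ≠ 0 := by
    rintro rfl
    simp at hz
  have hsq : 0 ≤ s * (z ^ 2).im := by
    have : s * (z ^ 2).im = 2 * z.re * (s * z.im) := by
      rw [sq, Complex.mul_im]
      ring
    rw [this]
    positivity
  have hstep : ∀ {a c : ℂ} {r : ℝ}, 0 ≤ r →
      0 ≤ s * (z * a * conj c).im → 0 ≤ s * (z * c * conj a).im →
      0 ≤ s * ((r * c + z * a) * conj c).im ∧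
        0 ≤ s * (z ^ 2 * conj ((r * c + z * a) * conj c)).im := by
    intro a c r hr h1 h2
    have e1 : (r * c + z * a) * conj c = (r * Complex.normSq c : ℝ) + z * a * conj c := by
      push_cast
      rw [Complex.normSq_eq_conj_mul_self]
      ring
    have e2 : z ^ 2 * conj ((r * c + z * a) * conj c)
        = (r * Complex.normSq c : ℝ) * z ^ 2 + (Complex.normSq z : ℝ) * (z * c * conj a) := by
      rw [e1]
      simp only [map_add, map_mul, Complex.conj_ofReal, Complex.conj_conj]
      rw [Complex.normSq_eq_conj_mul_self (z := z)]
      ring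
    rw [e2, e1, Complex.add_im, Complex.add_im, Complex.ofReal_im, Complex.im_ofReal_mul,
      Complex.im_ofReal_mul, zero_add]
    refine ⟨h1, ?_⟩
    have : 0 ≤ r * Complex.normSq c * (s * (z ^ 2).im)
        + Complex.normSq z * (s * (z * c * conj a).im) :=
      add_nonneg (mul_nonneg (mul_nonneg hr (Complex.normSq_nonneg _)) hsq)
        (mul_nonneg (Complex.normSq_nonneg _) h2)
    linarith
  induction n with
  | zero =>
    have h : 0 ≤ s * (z * sphk 0 z * conj (sphk 0 z)).im := by
      rw [mul_assoc, Complex.mul_conj, Complex.im_mul_ofReal, ← mul_assoc]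
      exact mul_nonneg hs (Complex.normSq_nonneg _)
    have e : z * sphk 1 z = ((1 : ℝ) : ℂ) * sphk 0 z + z * sphk 0 z := by
      rw [mul_sphk_one hz0]
      push_cast
      ring
    rw [zero_add, e]
    exact hstep zero_le_one h h
  | succ n ih =>
    have e : z * sphk (n + 2) z = ((2 * n + 3 : ℝ) : ℂ) * sphk (n + 1) z + z * sphk n z := by
      rw [mul_sphk_add_two hz0]
      push_cast
      ring
    rw [add_assoc, one_add_one_eq_two, e]
    refine hstep (by positivity) ?_ ih.1
    have e2 : z ^ 2 * conj (z * sphk (n + 1) z * conj (sphk n z))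
        = (Complex.normSq z : ℝ) * (z * sphk n z * conj (sphk (n + 1) z)) := by
      simp only [map_mul, Complex.conj_conj]
      rw [Complex.normSq_eq_conj_mul_self]
      ring
    have h := ih.2
    rw [e2, Complex.im_ofReal_mul, mul_left_comm] at h
    exact nonneg_of_mul_nonneg_right h (Complex.normSq_pos.mpr hz0)

lemma mul_im_logDeriv_sphk_nonpos {z : ℂ} (hz : 0 < z.re) {s : ℝ} (hs : 0 ≤ s * z.im) (n : ℕ) :
    s * (z * deriv (sphk n) z / sphk n z).im ≤ 0 := by
  have hz0 : z ≠ 0 := by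
    rintro rfl
    simp at hz
  by_cases hk : sphk n z = 0
  · simp [hk]
  have e : z * deriv (sphk n) z / sphk n z
      = (n : ℝ) - ((Complex.normSq (sphk n z))⁻¹ : ℝ)
          * (z * sphk (n + 1) z * conj (sphk n z)) := by
    have hc : conj (sphk n z) ≠ 0 := by simpa using hk
    rw [deriv_sphk hz0, Complex.ofReal_inv, Complex.normSq_eq_conj_mul_self]
    push_cast
    field_simp
  rw [e, Complex.sub_im, Complex.ofReal_im, Complex.im_ofReal_mul, zero_sub, mul_neg,
    mul_left_comm, neg_nonpos]
  exact mul_nonneg (inv_nonneg.mpr (Complex.normSq_nonneg _)) (sphk_ratio_mem_cone hz hs n).1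

/-- for `Re z > 0`, `Im(z)·Im(z k_n'(z)/k_n(z)) ≤ 0`; in particular
`Im(z k_n'(z)/k_n(z)) ≤ 0` when moreover `Im z ≥ 0`. -/
theorem stmt_10 (n : ℕ) (z : ℂ) (hz : 0 < z.re) :
    z.im * (z * deriv (sphk n) z / sphk n z).im ≤ 0 ∧
    (0 ≤ z.im → (z * deriv (sphk n) z / sphk n z).im ≤ 0) := by
  refine ⟨mul_im_logDeriv_sphk_nonpos hz (mul_self_nonneg _) n, fun him => ?_⟩
  simpa using mul_im_logDeriv_sphk_nonpos hz (s := 1) (by simpa using him) n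
end

section
/- For every integer n ≥ 0 and every real r > 0, the following identity holds in ℂ: [((−1)^{n+1}·K_{n+1}(r) + πi·I_{n+1}(r)) / ((−1)^n·K_n(r) + πi·I_n(r))] − [((−1)^{n+1}·K_{n+1}(r) − πi·I_{n+1}(r)) / ((−1)^n·K_n(r) − πi·I_n(r))] = (−1)^n · 2πi / ( r·(K_n(r)² + π²·I_n(r)²) ), where both denominators on the left are nonzero. -/
open MeasureTheory

open Filter Topology

lemma exp_neg_mul_cosh_mul_exp_le {x t : ℝ} (hx : 0 < x) (ht : 0 ≤ t) (m : ℝ) :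
    Real.exp (-x * Real.cosh t) * Real.exp (m * t) ≤
      Real.exp ((m + 1) ^ 2 / x) * Real.exp (-t) := by
  rw [← Real.exp_add, ← Real.exp_add, Real.exp_le_exp]
  have hcosh : t ^ 2 / 4 ≤ Real.cosh t := by
    rw [Real.cosh_eq]
    linarith [Real.quadratic_le_exp_of_nonneg ht, Real.exp_pos (-t)]
  have hsq : (m + 1) ^ 2 / x - (m + 1) * t + x * (t ^ 2 / 4) = (m + 1 - x * t / 2) ^ 2 / x := by
    field_simp
    ring
  have hnonneg : 0 ≤ (m + 1 - x * t / 2) ^ 2 / x := by positivity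
  nlinarith [mul_le_mul_of_nonneg_left hcosh hx.le]

lemma integrableOn_exp_neg_mul_cosh_mul {x : ℝ} (hx : 0 < x) {f : ℝ → ℝ} (hf : Continuous f)
    {m : ℝ} (hle : ∀ t, 0 ≤ t → |f t| ≤ Real.exp (m * t)) :
    IntegrableOn (fun t => Real.exp (-x * Real.cosh t) * f t) (Set.Ioi 0) := by
  refine Integrable.mono' ((integrableOn_exp_neg_Ioi 0).const_mul (Real.exp ((m + 1) ^ 2 / x)))
    (by fun_prop) ?_
  filter_upwards [ae_restrict_mem measurableSet_Ioi] with t ht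
  have ht' : 0 ≤ t := le_of_lt ht
  rw [Real.norm_eq_abs, abs_mul, Real.abs_exp]
  exact (mul_le_mul_of_nonneg_left (hle t ht') (Real.exp_pos _).le).trans
    (exp_neg_mul_cosh_mul_exp_le hx ht' m)

lemma tendsto_exp_neg_mul_cosh_mul {x : ℝ} (hx : 0 < x) {f : ℝ → ℝ}
    {m : ℝ} (hle : ∀ t, 0 ≤ t → |f t| ≤ Real.exp (m * t)) :
    Tendsto (fun t => Real.exp (-x * Real.cosh t) * f t) atTop (𝓝 0) := by
  have hlim : Tendsto (fun t => Real.exp ((m + 1) ^ 2 / x) * Real.exp (-t)) atTop (𝓝 0) := by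
    simpa using Real.tendsto_exp_neg_atTop_nhds_zero.const_mul (Real.exp ((m + 1) ^ 2 / x))
  refine squeeze_zero_norm' ?_ hlim
  filter_upwards [eventually_ge_atTop 0] with t ht
  rw [Real.norm_eq_abs, abs_mul, Real.abs_exp]
  exact (mul_le_mul_of_nonneg_left (hle t ht) (Real.exp_pos _).le).trans
    (exp_neg_mul_cosh_mul_exp_le hx ht m)

lemma Real.cosh_le_exp {s : ℝ} (hs : 0 ≤ s) : Real.cosh s ≤ Real.exp s := by
  rw [Real.cosh_eq]
  linarith [Real.exp_le_exp.2 (show -s ≤ s by linarith)]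

lemma abs_cosh_mul_le_exp {a t : ℝ} (ha : 0 ≤ a) (ht : 0 ≤ t) :
    |Real.cosh (a * t)| ≤ Real.exp (a * t) := by
  rw [abs_of_pos (Real.cosh_pos _)]
  exact Real.cosh_le_exp (mul_nonneg ha ht)

lemma abs_sinh_mul_le_exp {a t : ℝ} (ha : 0 ≤ a) (ht : 0 ≤ t) :
    |Real.sinh (a * t)| ≤ Real.exp (a * t) := by
  rw [abs_of_nonneg (Real.sinh_nonneg_iff.2 (mul_nonneg ha ht))]
  exact (Real.sinh_lt_cosh _).le.trans (Real.cosh_le_exp (mul_nonneg ha ht))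

lemma integrableOn_besselK (n : ℕ) {x : ℝ} (hx : 0 < x) :
    IntegrableOn (fun t => Real.exp (-x * Real.cosh t) * Real.cosh (n * t)) (Set.Ioi 0) :=
  integrableOn_exp_neg_mul_cosh_mul hx (by fun_prop)
    fun _ ht => abs_cosh_mul_le_exp n.cast_nonneg ht

lemma abs_cosh_mul_cosh_le_exp (n : ℕ) {t : ℝ} (ht : 0 ≤ t) :
    |Real.cosh t * Real.cosh (n * t)| ≤ Real.exp ((n + 1) * t) := by
  have h := mul_le_mul (abs_cosh_mul_le_exp zero_le_one ht)
    (abs_cosh_mul_le_exp n.cast_nonneg ht) (abs_nonneg _) (Real.exp_pos _).le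
  rw [one_mul, ← Real.exp_add] at h
  rw [abs_mul]
  exact h.trans_eq (by ring_nf)

lemma hasDerivAt_besselK (n : ℕ) {x : ℝ} (hx : 0 < x) :
    HasDerivAt (besselK n) (-∫ t in Set.Ioi (0 : ℝ),
      Real.exp (-x * Real.cosh t) * (Real.cosh t * Real.cosh (n * t))) x := by
  have h := hasDerivAt_integral_of_dominated_loc_of_deriv_le
    (μ := volume.restrict (Set.Ioi (0 : ℝ)))
    (F := fun y t => Real.exp (-y * Real.cosh t) * Real.cosh (n * t))
    (F' := fun y t => -(Real.exp (-y * Real.cosh t) * (Real.cosh t * Real.cosh (n * t))))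
    (bound := fun t => Real.exp (-(x / 2) * Real.cosh t) * (Real.cosh t * Real.cosh (n * t)))
    (Ioi_mem_nhds (half_lt_self hx)) (Eventually.of_forall fun y => by fun_prop)
    (integrableOn_besselK n hx) (by fun_prop) ?_
    (integrableOn_exp_neg_mul_cosh_mul (half_pos hx) (by fun_prop)
      fun t ht => abs_cosh_mul_cosh_le_exp n ht) ?_
  · rw [← integral_neg]
    exact h.2
  · refine Eventually.of_forall fun t y hy => ?_
    have hpos : 0 < Real.cosh t * Real.cosh (n * t) :=
      mul_pos (Real.cosh_pos _) (Real.cosh_pos _)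
    rw [norm_neg, Real.norm_eq_abs, abs_mul, Real.abs_exp, abs_of_pos hpos]
    refine mul_le_mul_of_nonneg_right (Real.exp_le_exp.2 ?_) hpos.le
    nlinarith [Set.mem_Ioi.1 hy, Real.cosh_pos t]
  · refine Eventually.of_forall fun t y _ => ?_
    have h1 : HasDerivAt (fun y : ℝ => -y * Real.cosh t) (-1 * Real.cosh t) y :=
      (hasDerivAt_id y).neg.mul_const _
    exact (h1.exp.mul_const (Real.cosh (n * t))).congr_deriv (by ring)

lemma hasDerivAt_besselK_zero {x : ℝ} (hx : 0 < x) :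
    HasDerivAt (besselK 0) (-besselK 1 x) x :=
  (hasDerivAt_besselK 0 hx).congr_deriv (by simp [besselK])

lemma hasDerivAt_besselK_succ (n : ℕ) {x : ℝ} (hx : 0 < x) :
    HasDerivAt (besselK (n + 1)) (-(besselK (n + 2) x + besselK n x) / 2) x := by
  refine (hasDerivAt_besselK (n + 1) hx).congr_deriv ?_
  rw [besselK, besselK, ← integral_add (integrableOn_besselK _ hx) (integrableOn_besselK _ hx),
    neg_div, ← integral_div]
  congr 2
  ext t
  have h1 : ((n + 2 : ℕ) : ℝ) * t = ((n + 1 : ℕ) : ℝ) * t + t := by push_cast; ring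
  have h2 : (n : ℝ) * t = ((n + 1 : ℕ) : ℝ) * t - t := by push_cast; ring
  rw [h1, h2, Real.cosh_add, Real.cosh_sub]
  ring

lemma besselK_recurrence (n : ℕ) {x : ℝ} (hx : 0 < x) :
    x * (besselK (n + 2) x - besselK n x) = 2 * (n + 1) * besselK (n + 1) x := by
  have hint := ((integrableOn_besselK (n + 1) hx).const_mul (2 * ((n : ℝ) + 1)))
  have hint' := (((integrableOn_besselK (n + 2) hx).sub (integrableOn_besselK n hx)).const_mul x)
  have h := integral_Ioi_of_hasDerivAt_of_tendsto
    (f := fun t => 2 * (Real.exp (-x * Real.cosh t) * Real.sinh (((n + 1 : ℕ) : ℝ) * t)))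
    (a := 0) (by fun_prop) ?_ (hint.sub hint')
    ((tendsto_exp_neg_mul_cosh_mul hx
      fun t ht => abs_sinh_mul_le_exp (n + 1).cast_nonneg ht).const_mul 2)
  · have hsub := integral_sub hint hint'
    have hsub' := integral_sub (integrableOn_besselK (n + 2) hx) (integrableOn_besselK n hx)
    simp only [Pi.sub_apply, integral_const_mul] at h hsub hsub'
    rw [hsub, hsub'] at h
    simp only [mul_zero, Real.sinh_zero, sub_zero] at h
    simp only [besselK]
    linarith
  · intro t _
    have h1 : HasDerivAt (fun t => -x * Real.cosh t) (-x * Real.sinh t) t :=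
      (Real.hasDerivAt_cosh t).const_mul _
    have h2 : HasDerivAt (fun t => Real.sinh (((n + 1 : ℕ) : ℝ) * t))
        (Real.cosh (((n + 1 : ℕ) : ℝ) * t) * (((n + 1 : ℕ) : ℝ) * 1)) t :=
      ((hasDerivAt_id t).const_mul _).sinh
    refine ((h1.exp.mul h2).const_mul 2).congr_deriv ?_
    have e1 : ((n + 2 : ℕ) : ℝ) * t = ((n + 1 : ℕ) : ℝ) * t + t := by push_cast; ring
    have e2 : (n : ℝ) * t = ((n + 1 : ℕ) : ℝ) * t - t := by push_cast; ring
    simp only [Pi.sub_apply]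
    rw [e1, e2, Real.cosh_add, Real.cosh_sub]
    push_cast
    ring

lemma besselK_nonneg (n : ℕ) (x : ℝ) : 0 ≤ besselK n x :=
  integral_nonneg fun _ => mul_nonneg (Real.exp_pos _).le (Real.cosh_pos _).le

lemma besselK_zero_le_besselK_one {x : ℝ} (hx : 0 < x) : besselK 0 x ≤ besselK 1 x := by
  refine integral_mono (integrableOn_besselK 0 hx) (integrableOn_besselK 1 hx) fun t => ?_
  simp only [Nat.cast_zero, Nat.cast_one, zero_mul, one_mul, Real.cosh_zero]
  exact mul_le_mul_of_nonneg_left (Real.one_le_cosh t) (Real.exp_pos _).le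

lemma mul_integral_exp_neg_mul_cosh_mul_sinh {x : ℝ} (hx : 0 < x) :
    x * ∫ t in Set.Ioi (0 : ℝ), Real.exp (-x * Real.cosh t) * Real.sinh t = Real.exp (-x) := by
  have hint : IntegrableOn (fun t => Real.exp (-x * Real.cosh t) * Real.sinh t) (Set.Ioi 0) :=
    integrableOn_exp_neg_mul_cosh_mul (m := 1) hx (by fun_prop)
      fun t ht => by simpa using abs_sinh_mul_le_exp zero_le_one ht
  have h := integral_Ioi_of_hasDerivAt_of_tendsto
    (f := fun t => -(Real.exp (-x * Real.cosh t) * 1)) (a := 0) (by fun_prop) ?_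
    (hint.const_mul x)
    (tendsto_exp_neg_mul_cosh_mul (m := 0) hx (f := fun _ => 1) (by simp)).neg
  · rw [integral_const_mul] at h
    simpa using h
  · intro t _
    have h1 : HasDerivAt (fun t => -x * Real.cosh t) (-x * Real.sinh t) t :=
      (Real.hasDerivAt_cosh t).const_mul _
    exact (h1.exp.mul_const 1).neg.congr_deriv (by ring)

lemma exp_neg_le_mul_besselK_one {x : ℝ} (hx : 0 < x) : Real.exp (-x) ≤ x * besselK 1 x := by
  rw [← mul_integral_exp_neg_mul_cosh_mul_sinh hx]
  refine mul_le_mul_of_nonneg_left ?_ hx.le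
  refine integral_mono (integrableOn_exp_neg_mul_cosh_mul (m := 1) hx (by fun_prop)
      fun t ht => by simpa using abs_sinh_mul_le_exp zero_le_one ht)
    (integrableOn_besselK 1 hx) fun t => ?_
  simp only [Nat.cast_one, one_mul]
  exact mul_le_mul_of_nonneg_left (Real.sinh_lt_cosh t).le (Real.exp_pos _).le

lemma mul_besselK_one_le {x : ℝ} (hx : 0 < x) : x * besselK 1 x ≤ Real.exp (-x) + x := by
  have hint : IntegrableOn (fun t => Real.exp (-x * Real.cosh t) * Real.sinh t) (Set.Ioi 0) :=
    integrableOn_exp_neg_mul_cosh_mul (m := 1) hx (by fun_prop)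
      fun t ht => by simpa using abs_sinh_mul_le_exp zero_le_one ht
  have h : besselK 1 x ≤ (∫ t in Set.Ioi (0 : ℝ), Real.exp (-x * Real.cosh t) * Real.sinh t) +
      ∫ t in Set.Ioi (0 : ℝ), Real.exp (-t) := by
    rw [← integral_add hint (integrableOn_exp_neg_Ioi 0)]
    refine integral_mono (integrableOn_besselK 1 hx)
      (hint.add (integrableOn_exp_neg_Ioi 0)) fun t => ?_
    have h1 : Real.exp (-x * Real.cosh t) ≤ 1 :=
      Real.exp_le_one_iff.2 (by nlinarith [Real.cosh_pos t])
    have h2 := Real.cosh_sub_sinh t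
    simp only [Nat.cast_one, one_mul]
    nlinarith [Real.exp_pos (-t)]
  rw [integral_exp_neg_Ioi_zero] at h
  rw [← mul_integral_exp_neg_mul_cosh_mul_sinh hx]
  nlinarith

lemma tendsto_mul_besselK_one : Tendsto (fun x => x * besselK 1 x) (𝓝[>] 0) (𝓝 1) := by
  have h1 : Tendsto (fun x : ℝ => Real.exp (-x)) (𝓝[>] 0) (𝓝 1) := by
    have : Continuous fun x : ℝ => Real.exp (-x) := by fun_prop
    simpa using (this.tendsto 0).mono_left nhdsWithin_le_nhds
  have h2 : Tendsto (fun x : ℝ => Real.exp (-x) + x) (𝓝[>] 0) (𝓝 1) := by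
    have : Continuous fun x : ℝ => Real.exp (-x) + x := by fun_prop
    simpa using (this.tendsto 0).mono_left nhdsWithin_le_nhds
  refine tendsto_of_tendsto_of_tendsto_of_le_of_le' h1 h2 ?_ ?_
  · filter_upwards [self_mem_nhdsWithin] with x hx using exp_neg_le_mul_besselK_one hx
  · filter_upwards [self_mem_nhdsWithin] with x hx using mul_besselK_one_le hx

/-- The entire function `∑ yᵏ / (k! (n + k)!)`, for which
`besselI n x = (x / 2) ^ n * besselISeries n (x ^ 2 / 4)`. -/
noncomputable def besselISeries (n : ℕ) (y : ℝ) : ℝ :=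
  ∑' k : ℕ, y ^ k / (Nat.factorial k * Nat.factorial (n + k))

lemma norm_pow_div_factorial_mul_factorial_le (n k : ℕ) (y : ℝ) :
    ‖y ^ k / (Nat.factorial k * Nat.factorial (n + k) : ℝ)‖ ≤ |y| ^ k / Nat.factorial k := by
  have h1 : (1 : ℝ) ≤ Nat.factorial (n + k) := by
    exact_mod_cast Nat.succ_le_of_lt (n + k).factorial_pos
  have h2 : (0 : ℝ) < Nat.factorial k := by exact_mod_cast k.factorial_pos
  rw [norm_div, norm_pow, Real.norm_eq_abs, Real.norm_of_nonneg (by positivity)]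
  gcongr
  nlinarith

lemma summable_besselISeries (n : ℕ) (y : ℝ) :
    Summable fun k : ℕ => y ^ k / (Nat.factorial k * Nat.factorial (n + k) : ℝ) :=
  Summable.of_norm_bounded (Real.summable_pow_div_factorial |y|)
    fun k => norm_pow_div_factorial_mul_factorial_le n k y

lemma besselI_eq (n : ℕ) (x : ℝ) :
    besselI n x = (x / 2) ^ n * besselISeries n (x ^ 2 / 4) := by
  rw [besselI, besselISeries, ← tsum_mul_left]
  congr 1
  ext k
  rw [pow_add, pow_mul, mul_div_assoc]
  congr 3
  ring

lemma succ_mul_pow_div_factorial (n k : ℕ) (y : ℝ) :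
    ((k + 1 : ℕ) : ℝ) * y ^ k / (Nat.factorial (k + 1) * Nat.factorial (n + (k + 1))) =
      y ^ k / (Nat.factorial k * Nat.factorial (n + 1 + k)) := by
  have h : n + (k + 1) = n + 1 + k := by ring
  rw [h, Nat.factorial_succ k]
  push_cast
  have h2 : (Nat.factorial k : ℝ) ≠ 0 := by exact_mod_cast k.factorial_ne_zero
  have h3 : (Nat.factorial (n + 1 + k) : ℝ) ≠ 0 := by exact_mod_cast Nat.factorial_ne_zero _
  field_simp

lemma hasDerivAt_besselISeries (n : ℕ) (y : ℝ) :
    HasDerivAt (besselISeries n) (besselISeries (n + 1) y) y := by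
  have hterm : ∀ z : ℝ, (fun k : ℕ => ((k + 1 : ℕ) : ℝ) * z ^ k /
      (Nat.factorial (k + 1) * Nat.factorial (n + (k + 1)))) =
      fun k : ℕ => z ^ k / (Nat.factorial k * Nat.factorial (n + 1 + k) : ℝ) := fun z =>
    funext fun k => succ_mul_pow_div_factorial n k z
  set R := |y| + 1 with hR
  have hR0 : 0 ≤ R := by positivity
  have hsum : ∀ z : ℝ, Summable fun k : ℕ => (k : ℝ) * z ^ (k - 1) /
      (Nat.factorial k * Nat.factorial (n + k)) := fun z => by
    rw [← summable_nat_add_iff 1]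
    simp only [Nat.add_sub_cancel, hterm]
    exact summable_besselISeries (n + 1) z
  have h := hasDerivAt_tsum_of_isPreconnected (𝕜 := ℝ)
    (g := fun (k : ℕ) (z : ℝ) => z ^ k / (Nat.factorial k * Nat.factorial (n + k) : ℝ))
    (g' := fun (k : ℕ) (z : ℝ) => (k : ℝ) * z ^ (k - 1) /
      (Nat.factorial k * Nat.factorial (n + k)))
    (y₀ := y) (y := y) (hsum R) Metric.isOpen_ball (convex_ball (0 : ℝ) R).isPreconnected
    (fun k z _ => (hasDerivAt_pow k z).div_const _) ?_ (by simp [hR])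
    (summable_besselISeries n y) (by simp [hR])
  · refine h.congr_deriv ?_
    rw [(hsum y).tsum_eq_zero_add]
    simp only [Nat.add_sub_cancel, hterm]
    simp [besselISeries]
  · intro k z hz
    have hz' : |z| ≤ R := by simpa using (mem_ball_zero_iff.1 hz).le
    rw [norm_div, norm_mul, norm_pow, Real.norm_eq_abs z, Real.norm_of_nonneg (by positivity),
      Real.norm_of_nonneg (by positivity)]
    gcongr

lemma besselISeries_recurrence (n : ℕ) (y : ℝ) :
    besselISeries n y = (n + 1) * besselISeries (n + 1) y + y * besselISeries (n + 2) y := by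
  simp only [besselISeries]
  rw [(summable_besselISeries n y).tsum_eq_zero_add,
    (summable_besselISeries (n + 1) y).tsum_eq_zero_add, mul_add, ← tsum_mul_left,
    ← tsum_mul_left, add_assoc, ← Summable.tsum_add]
  · congr 1
    · have h : (Nat.factorial n : ℝ) ≠ 0 := by exact_mod_cast n.factorial_ne_zero
      simp [Nat.factorial_succ]
      field_simp
    · congr 1
      ext k
      have e1 : n + (k + 1) = n + k + 1 := by ring
      have e2 : n + 1 + (k + 1) = n + k + 1 + 1 := by ring
      have e3 : n + 2 + k = n + k + 1 + 1 := by ring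
      rw [e1, e2, e3, Nat.factorial_succ (n + k + 1), Nat.factorial_succ k]
      have h2 : (Nat.factorial k : ℝ) ≠ 0 := by exact_mod_cast k.factorial_ne_zero
      have h3 : (Nat.factorial (n + k + 1) : ℝ) ≠ 0 := by exact_mod_cast Nat.factorial_ne_zero _
      push_cast
      field_simp
      ring
  · exact ((summable_nat_add_iff 1).2 (summable_besselISeries (n + 1) y)).mul_left _
  · exact (summable_besselISeries (n + 2) y).mul_left _

lemma besselI_recurrence (n : ℕ) (x : ℝ) :
    x * (besselI n x - besselI (n + 2) x) = 2 * (n + 1) * besselI (n + 1) x := by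
  rw [besselI_eq, besselI_eq, besselI_eq, besselISeries_recurrence n]
  ring

lemma hasDerivAt_besselI_zero (x : ℝ) : HasDerivAt (besselI 0) (besselI 1 x) x := by
  have h : HasDerivAt (fun x : ℝ => x ^ 2 / 4) (2 * x / 4) x := by
    simpa using (hasDerivAt_pow 2 x).div_const 4
  have heq : besselI 0 = fun x => besselISeries 0 (x ^ 2 / 4) := by
    ext z
    simp [besselI_eq]
  rw [heq, besselI_eq]
  exact ((hasDerivAt_besselISeries 0 _).comp x h).congr_deriv (by ring)

lemma hasDerivAt_mul_besselI_one (x : ℝ) :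
    HasDerivAt (fun x => x * besselI 1 x) (x * besselI 0 x) x := by
  have h : HasDerivAt (fun x : ℝ => x ^ 2 / 4) (2 * x / 4) x := by
    simpa using (hasDerivAt_pow 2 x).div_const 4
  have heq : (fun x => x * besselI 1 x) =
      fun x => 2 * (x ^ 2 / 4) * besselISeries 1 (x ^ 2 / 4) := by
    ext z
    rw [besselI_eq]
    ring
  rw [heq, besselI_eq, besselISeries_recurrence]
  exact ((h.const_mul 2).mul ((hasDerivAt_besselISeries 1 _).comp x h)).congr_deriv
    (by simp only [Function.comp_apply]; push_cast; ring)

lemma continuous_besselI_one : Continuous (besselI 1) := by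
  have h : Continuous (besselISeries 1) :=
    continuous_iff_continuousAt.2 fun y => (hasDerivAt_besselISeries 1 y).continuousAt
  have heq : besselI 1 = fun x => (x / 2) ^ 1 * besselISeries 1 (x ^ 2 / 4) :=
    funext (besselI_eq 1)
  rw [heq]
  fun_prop

lemma besselI_zero_zero : besselI 0 0 = 1 := by
  rw [besselI, tsum_eq_single 0 fun k hk => by simp [hk]]
  simp

lemma besselI_one_zero : besselI 1 0 = 0 := by
  simp [besselI_eq]

lemma hasDerivAt_mul_wronskian_zero {x : ℝ} (hx : 0 < x) :
    HasDerivAt (fun x => x * besselK 1 x * besselI 0 x + x * besselI 1 x * besselK 0 x) 0 x := by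
  have h1 := ((hasDerivAt_id x).mul (hasDerivAt_besselK_succ 0 hx)).mul (hasDerivAt_besselI_zero x)
  have h2 := (hasDerivAt_mul_besselI_one x).mul (hasDerivAt_besselK_zero hx)
  refine (h1.add h2).congr_deriv ?_
  have hrec := besselK_recurrence 0 hx
  simp only [Nat.cast_zero, zero_add, id_eq, Pi.mul_apply] at hrec ⊢
  linear_combination (-(besselI 0 x) / 2) * hrec

lemma tendsto_mul_wronskian_zero :
    Tendsto (fun x => x * besselK 1 x * besselI 0 x + x * besselI 1 x * besselK 0 x)
      (𝓝[>] 0) (𝓝 1) := by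
  have hI0 : Tendsto (besselI 0) (𝓝[>] 0) (𝓝 1) := by
    rw [← besselI_zero_zero]
    exact (hasDerivAt_besselI_zero 0).continuousAt.tendsto.mono_left nhdsWithin_le_nhds
  have hI1 : Tendsto (besselI 1) (𝓝[>] 0) (𝓝 0) := by
    conv => arg 3; rw [← besselI_one_zero]
    exact continuous_besselI_one.continuousAt.tendsto.mono_left nhdsWithin_le_nhds
  have hprod : Tendsto (fun x => x * besselI 1 x * besselK 0 x) (𝓝[>] 0) (𝓝 0) := by
    have hbound : Tendsto (fun x => x * besselK 1 x * |besselI 1 x|) (𝓝[>] 0) (𝓝 0) := by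
      simpa using tendsto_mul_besselK_one.mul hI1.abs
    refine squeeze_zero_norm' ?_ hbound
    filter_upwards [self_mem_nhdsWithin] with x hx
    rw [Real.norm_eq_abs, abs_mul, abs_mul, abs_of_pos (Set.mem_Ioi.1 hx),
      abs_of_nonneg (besselK_nonneg 0 x), mul_right_comm]
    have hx' : 0 < x := hx
    gcongr
    exact besselK_zero_le_besselK_one hx
  simpa using (tendsto_mul_besselK_one.mul hI0).add hprod

lemma besselK_besselI_wronskian (n : ℕ) {x : ℝ} (hx : 0 < x) :
    x * (besselK (n + 1) x * besselI n x + besselI (n + 1) x * besselK n x) = 1 := by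
  induction n with
  | zero =>
    obtain ⟨a, ha⟩ := isOpen_Ioi.exists_is_const_of_deriv_eq_zero isPreconnected_Ioi
      (fun y hy => (hasDerivAt_mul_wronskian_zero hy).differentiableAt.differentiableWithinAt)
      (fun y hy => (hasDerivAt_mul_wronskian_zero hy).deriv)
    have hconst : Tendsto (fun x => x * besselK 1 x * besselI 0 x + x * besselI 1 x * besselK 0 x)
        (𝓝[>] 0) (𝓝 a) :=
      tendsto_const_nhds.congr' (by
        filter_upwards [self_mem_nhdsWithin] with y hy using (ha y hy).symm)
    have hval := ha x hx
    rw [tendsto_nhds_unique hconst tendsto_mul_wronskian_zero] at hval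
    rw [← hval]
    ring
  | succ n ih =>
    rw [← ih]
    linear_combination besselI (n + 1) x * besselK_recurrence n hx -
      besselK (n + 1) x * besselI_recurrence n x

/-- the Wronskian-type identity used in the derivation of the 2-D kernel. -/
theorem stmt_17 (n : ℕ) (r : ℝ) (hr : 0 < r) :
    ((-1:ℂ)^n * (besselK n r : ℂ) + Real.pi * Complex.I * (besselI n r : ℂ)) ≠ 0 ∧
    ((-1:ℂ)^n * (besselK n r : ℂ) - Real.pi * Complex.I * (besselI n r : ℂ)) ≠ 0 ∧
    ((-1:ℂ)^(n+1) * (besselK (n+1) r : ℂ) + Real.pi * Complex.I * (besselI (n+1) r : ℂ))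
        / ((-1:ℂ)^n * (besselK n r : ℂ) + Real.pi * Complex.I * (besselI n r : ℂ))
      - ((-1:ℂ)^(n+1) * (besselK (n+1) r : ℂ) - Real.pi * Complex.I * (besselI (n+1) r : ℂ))
        / ((-1:ℂ)^n * (besselK n r : ℂ) - Real.pi * Complex.I * (besselI n r : ℂ))
      = (-1:ℂ)^n * 2 * Real.pi * Complex.I
          / ((r:ℂ) * (((besselK n r)^2 + Real.pi^2 * (besselI n r)^2 : ℝ) : ℂ)) := by
  have hW := besselK_besselI_wronskian n hr
  have hne : ∀ ε : ℝ, ε ≠ 0 →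
      (-1 : ℂ) ^ n * (besselK n r : ℂ) + ε * Complex.I * (besselI n r : ℂ) ≠ 0 := by
    intro ε hε h
    have hcast : (((-1 : ℝ) ^ n * besselK n r : ℝ) : ℂ) + ((ε * besselI n r : ℝ) : ℂ) * Complex.I
        = 0 := by
      rw [← h]
      push_cast
      ring
    have hre := congrArg Complex.re hcast
    have him := congrArg Complex.im hcast
    simp only [Complex.add_re, Complex.add_im, Complex.ofReal_re, Complex.ofReal_im,
      Complex.re_ofReal_mul, Complex.im_ofReal_mul, Complex.I_re, Complex.I_im, Complex.zero_re,
      Complex.zero_im, mul_zero, mul_one, add_zero, zero_add] at hre him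
    have hK : besselK n r = 0 := by simpa using hre
    have hI : besselI n r = 0 := by simpa [hε] using him
    simp [hK, hI] at hW
  have hplus := hne Real.pi Real.pi_ne_zero
  have hminus : (-1 : ℂ) ^ n * (besselK n r : ℂ) - Real.pi * Complex.I * (besselI n r : ℂ) ≠ 0 := by
    have h := hne (-Real.pi) (neg_ne_zero.2 Real.pi_ne_zero)
    push_cast at h
    rwa [neg_mul, neg_mul, ← sub_eq_add_neg] at h
  refine ⟨hplus, hminus, ?_⟩
  have hW' : (r : ℂ) * (besselK (n + 1) r * besselI n r + besselI (n + 1) r * besselK n r) = 1 := by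
    exact_mod_cast hW
  have hs : ((-1 : ℂ) ^ n) ^ 2 = 1 := by rw [← pow_mul, mul_comm, pow_mul]; simp
  have hprod : (((besselK n r) ^ 2 + Real.pi ^ 2 * (besselI n r) ^ 2 : ℝ) : ℂ) =
      ((-1 : ℂ) ^ n * (besselK n r : ℂ) + Real.pi * Complex.I * (besselI n r : ℂ)) *
      ((-1 : ℂ) ^ n * (besselK n r : ℂ) - Real.pi * Complex.I * (besselI n r : ℂ)) := by
    push_cast
    linear_combination (-(besselK n r : ℂ) ^ 2) * hs +
      (Real.pi : ℂ) ^ 2 * (besselI n r : ℂ) ^ 2 * Complex.I_sq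
  have hr' : (r : ℂ) ≠ 0 := by exact_mod_cast hr.ne'
  rw [hprod, div_sub_div _ _ hplus hminus, div_eq_div_iff (mul_ne_zero hplus hminus)
    (mul_ne_zero hr' (mul_ne_zero hplus hminus)), pow_succ]
  linear_combination ((-1 : ℂ) ^ n * 2 * Real.pi * Complex.I) *
    (((-1 : ℂ) ^ n * (besselK n r : ℂ) + Real.pi * Complex.I * (besselI n r : ℂ)) *
      ((-1 : ℂ) ^ n * (besselK n r : ℂ) - Real.pi * Complex.I * (besselI n r : ℂ))) * hW'
end
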